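/- Unisolvence of the quadrilateral Lin–Tobiska–Zhou (QLTZ) element on a general convex quadrilateral: with r, s, O and the affine coordinates ξ, η as in the context, let A₁ = O + (−1−α)r + (1−β)s, A₂ = O + (−1+α)r + (−1+β)s, A₃ = O + (1−α)r + (−1−β)s, A₄ = O + (1+α)r + (1+β)s be the vertices of the convex quadrilateral Q := conv{A₁, A₂, A₃, A₄}, with edges E₁ = [A₁,A₂], E₂ = [A₂,A₃], E₃ = [A₃,A₄], E₄ = [A₄,A₁]. Then the linear map from P_Q := span_ℝ{1, ξ, η, ξ², η²} to ℝ⁵ given by v ↦ (⨍_Q v, ⨍_{E₁}v, ⨍_{E₂}v, ⨍_{E₃}v, ⨍_{E₄}v) is bijective. -/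

import Mathlib

open MeasureTheory

noncomputable section

/-- Average of `u` over the segment with endpoints `P` and `R`:
    ⨍ u = ∫_{t ∈ [0,1]} u((1−t)P + tR) dt. -/
def segAvg (P R : ℝ × ℝ) (u : ℝ × ℝ → ℝ) : ℝ :=
  ∫ t in (0:ℝ)..1, u ((1 - t) • P + t • R)

/-- Average of `u` over a set S: (∫_S u dλ)/λ(S), λ Lebesgue measure on ℝ². -/
def setAvg (S : Set (ℝ × ℝ)) (u : ℝ × ℝ → ℝ) : ℝ :=
  (∫ p in S, u p) / (volume S).toReal

theorem det_ne_zero_of_linearIndependent {r s : ℝ × ℝ} (h : LinearIndependent ℝ ![r, s]) :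
    r.1 * s.2 - r.2 * s.1 ≠ 0 := by
  intro hD
  rw [LinearIndependent.pair_iff] at h
  have h1 := h s.2 (-r.2) (by ext <;> simp <;> linarith)
  have h2 := h s.1 (-r.1) (by ext <;> simp <;> linarith)
  have := h 1 0 (by ext <;> simp <;> linarith)
  simp at this

theorem coord_unique {r s O : ℝ × ℝ} (h : LinearIndependent ℝ ![r, s]) {a b c d : ℝ}
    (heq : O + a • r + b • s = O + c • r + d • s) : a = c ∧ b = d := by
  rw [LinearIndependent.pair_iff] at h
  have := h (a - c) (b - d) (by
    rw [add_assoc, add_assoc, add_right_inj] at heq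
    rw [sub_smul, sub_smul, sub_add_sub_comm, heq, sub_self])
  constructor <;> linarith

/-- The bilinear map from the reference square onto the quadrilateral. -/
def bilinearMap (α β : ℝ) (r s O p : ℝ × ℝ) : ℝ × ℝ :=
  O + (p.1 * (1 + α * p.2)) • r + (p.2 * (1 + β * p.1)) • s

/-- The derivative of `bilinearMap` at `p`. -/
def bilinearMapDeriv (α β : ℝ) (r s p : ℝ × ℝ) : ℝ × ℝ →L[ℝ] ℝ × ℝ :=
  (Matrix.toLin (Module.Basis.finTwoProd ℝ) (Module.Basis.finTwoProd ℝ)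
    !![(1 + α * p.2) * r.1 + β * p.2 * s.1, α * p.1 * r.1 + (1 + β * p.1) * s.1;
       (1 + α * p.2) * r.2 + β * p.2 * s.2, α * p.1 * r.2 + (1 + β * p.1) * s.2]
    ).toContinuousLinearMap

theorem det_bilinearMapDeriv (α β : ℝ) (r s p : ℝ × ℝ) :
    (bilinearMapDeriv α β r s p).det
      = (1 + α * p.2 + β * p.1) * (r.1 * s.2 - r.2 * s.1) := by
  simp only [bilinearMapDeriv, LinearMap.det_toContinuousLinearMap, LinearMap.det_toLin,
    Matrix.det_fin_two_of]
  ring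

theorem hasFDerivAt_bilinearMap (α β : ℝ) (r s O p : ℝ × ℝ) :
    HasFDerivAt (bilinearMap α β r s O) (bilinearMapDeriv α β r s p) p := by
  have h1 : HasFDerivAt (fun p : ℝ × ℝ => p.1) (ContinuousLinearMap.fst ℝ ℝ ℝ) p := hasFDerivAt_fst
  have h2 : HasFDerivAt (fun p : ℝ × ℝ => p.2) (ContinuousLinearMap.snd ℝ ℝ ℝ) p := hasFDerivAt_snd
  have hX := h1.mul ((h2.const_mul α).const_add 1)
  have hY := h2.mul ((h1.const_mul β).const_add 1)
  refine (((hX.smul_const r).const_add O).add (hY.smul_const s)).congr_fderiv ?_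
  ext <;> simp [bilinearMapDeriv, Matrix.toLin_finTwoProd_apply, mul_comm]

theorem integral_cubic_symm (c₀ c₁ c₂ c₃ : ℝ) :
    ∫ x in (-1 : ℝ)..1, (c₀ + c₁ * x + c₂ * x ^ 2 + c₃ * x ^ 3) = 2 * c₀ + 2 / 3 * c₂ := by
  have i {f : ℝ → ℝ} (hf : Continuous f) : IntervalIntegrable f volume (-1) 1 :=
    hf.intervalIntegrable _ _
  rw [intervalIntegral.integral_add (i (by fun_prop)) (i (by fun_prop)),
    intervalIntegral.integral_add (i (by fun_prop)) (i (by fun_prop)),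
    intervalIntegral.integral_add (i (by fun_prop)) (i (by fun_prop))]
  rw [intervalIntegral.integral_const_mul c₁]
  simp only [intervalIntegral.integral_const_mul, integral_pow, integral_id,
    intervalIntegral.integral_const, smul_eq_mul]
  norm_num
  ring

theorem integral_quadratic_unit (c₀ c₁ c₂ : ℝ) :
    ∫ x in (0 : ℝ)..1, (c₀ + c₁ * x + c₂ * x ^ 2) = c₀ + c₁ / 2 + c₂ / 3 := by
  have i {f : ℝ → ℝ} (hf : Continuous f) : IntervalIntegrable f volume 0 1 :=
    hf.intervalIntegrable _ _
  rw [intervalIntegral.integral_add (i (by fun_prop)) (i (by fun_prop)),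
    intervalIntegral.integral_add (i (by fun_prop)) (i (by fun_prop))]
  rw [intervalIntegral.integral_const_mul c₁]
  simp only [intervalIntegral.integral_const_mul, integral_pow, integral_id,
    intervalIntegral.integral_const, smul_eq_mul]
  norm_num
  ring

theorem setIntegral_square {f : ℝ × ℝ → ℝ} (hf : Continuous f) :
    ∫ p in Set.Icc (-1 : ℝ) 1 ×ˢ Set.Icc (-1 : ℝ) 1, f p
      = ∫ x in (-1 : ℝ)..1, ∫ y in (-1 : ℝ)..1, f (x, y) := by
  rw [Measure.volume_eq_prod, setIntegral_prod _ (by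
    rw [← Measure.volume_eq_prod]
    exact hf.continuousOn.integrableOn_compact (isCompact_Icc.prod isCompact_Icc))]
  simp only [integral_Icc_eq_integral_Ioc,
    intervalIntegral.integral_of_le (show (-1 : ℝ) ≤ 1 by norm_num)]

/-- The general element of the span of `1`, `y`, `x`, `y²`, `x²`. -/
def separableQuadratic (a b c d e x y : ℝ) : ℝ := a + b * y + c * x + d * y ^ 2 + e * x ^ 2

theorem setIntegral_square_jacobian_mul (α β a b c d e : ℝ) :
    ∫ p in Set.Icc (-1 : ℝ) 1 ×ˢ Set.Icc (-1 : ℝ) 1, (1 + α * p.2 + β * p.1) *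
        separableQuadratic a b c d e (p.1 * (1 + α * p.2)) (p.2 * (1 + β * p.1))
      = 4 * (a + b * α / 3 + c * β / 3 + d * (1 + β ^ 2) / 3 + e * (1 + α ^ 2) / 3) := by
  unfold separableQuadratic
  rw [setIntegral_square (by fun_prop)]
  have inner (x : ℝ) :
      ∫ y in (-1 : ℝ)..1, (1 + α * y + β * x) * (a + b * (y * (1 + β * x)) + c * (x * (1 + α * y))
          + d * (y * (1 + β * x)) ^ 2 + e * (x * (1 + α * y)) ^ 2)
        = 2 * ((1 + β * x) * (a + c * x + e * x ^ 2))
          + 2 / 3 * ((1 + β * x) * (d * (1 + β * x) ^ 2 + e * x ^ 2 * α ^ 2)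
            + α * (b * (1 + β * x) + c * x * α + 2 * e * x ^ 2 * α)) := by
    rw [← integral_cubic_symm _
      ((1 + β * x) * (b * (1 + β * x) + c * x * α + 2 * e * x ^ 2 * α)
        + α * (a + c * x + e * x ^ 2)) _
      (α * (d * (1 + β * x) ^ 2 + e * x ^ 2 * α ^ 2))]
    congr 1
    ext y
    ring
  simp only [inner]
  calc
    _ = ∫ x in (-1 : ℝ)..1, ((2 * a + 2 / 3 * (d + α * b))
          + (2 * (β * a + c) + 2 / 3 * (3 * d * β + α * b * β + α ^ 2 * c)) * x
          + (2 * (β * c + e) + 2 / 3 * (3 * d * β ^ 2 + 3 * e * α ^ 2)) * x ^ 2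
          + (2 * β * e + 2 / 3 * (d * β ^ 3 + β * e * α ^ 2)) * x ^ 3) := by
      congr 1
      ext x
      ring
    _ = _ := by
      rw [integral_cubic_symm]
      ring

theorem injOn_bilinearMap {α β : ℝ} (hα : 0 < α) (hβ : 0 < β) (hαβ : α + β < 1)
    {r s : ℝ × ℝ} (hrs : LinearIndependent ℝ ![r, s]) (O : ℝ × ℝ) :
    Set.InjOn (bilinearMap α β r s O) (Set.Icc (-1 : ℝ) 1 ×ˢ Set.Icc (-1 : ℝ) 1) := by
  rintro ⟨x, y⟩ ⟨⟨hx, hx'⟩, hy, hy'⟩ ⟨z, w⟩ ⟨⟨hz, hz'⟩, hw, hw'⟩ h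
  obtain ⟨h1, h2⟩ := coord_unique hrs h
  dsimp only at *
  have hJ : 1 + α * ((y + w) / 2) + β * ((x + z) / 2) ≠ 0 := by nlinarith
  have hxz : x - z = 0 := by
    refine (mul_eq_zero.1
      (?_ : (1 + α * ((y + w) / 2) + β * ((x + z) / 2)) * (x - z) = 0)).resolve_left hJ
    linear_combination (1 + β * ((x + z) / 2)) * h1 - α * ((x + z) / 2) * h2
  have hyw : y - w = 0 := by
    refine (mul_eq_zero.1
      (?_ : (1 + α * ((y + w) / 2) + β * ((x + z) / 2)) * (y - w) = 0)).resolve_left hJ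
    linear_combination (1 + α * ((y + w) / 2)) * h2 - β * ((y + w) / 2) * h1
  ext <;> simp <;> linarith

/-- The intersection of the four half-planes, in coordinates, is covered by the square. -/
theorem exists_bilinear_preimage {α β x y : ℝ} (hα : 0 < α) (hβ : 0 < β) (hαβ : α + β < 1)
    (h₁ : 0 ≤ (1 - β) * (x + 1) + α * y) (h₂ : 0 ≤ (1 - α) * (y + 1) + β * x)
    (h₃ : 0 ≤ (1 + β) * (1 - x) + α * y) (h₄ : 0 ≤ (1 + α) * (1 - y) + β * x) :
    ∃ p ∈ Set.Icc (-1 : ℝ) 1 ×ˢ Set.Icc (-1 : ℝ) 1,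
      p.1 * (1 + α * p.2) = x ∧ p.2 * (1 + β * p.1) = y := by
  obtain ⟨w, ⟨hw, hw'⟩, hw0⟩ := intermediate_value_Icc (show (-1 : ℝ) ≤ 1 by norm_num)
    (f := fun w => w * (1 + α * w) + β * x * w - y * (1 + α * w)) (by fun_prop)
    (show (0 : ℝ) ∈ _ from ⟨by linarith, by linarith⟩)
  dsimp only at hw0
  have hpos : 0 < 1 + α * w := by nlinarith
  have hz : x / (1 + α * w) * (1 + α * w) = x := div_mul_cancel₀ _ hpos.ne'
  set z := x / (1 + α * w)
  have hy : w * (1 + β * z) = y := by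
    apply mul_right_cancel₀ hpos.ne'
    linear_combination hw0 + β * w * hz
  refine ⟨(z, w), ⟨⟨?_, ?_⟩, hw, hw'⟩, hz, hy⟩
  · have : 0 ≤ (z + 1) * (1 - β + α * w) := by
      linear_combination h₁ - (1 - β) * hz - α * hy
    have := nonneg_of_mul_nonneg_left this (by nlinarith)
    dsimp only; linarith
  · have : 0 ≤ (1 - z) * (1 + β + α * w) := by
      linear_combination h₃ + (1 + β) * hz - α * hy
    have := nonneg_of_mul_nonneg_left this (by nlinarith)
    dsimp only; linarith

theorem image_bilinearMap_square {α β : ℝ} (hα : 0 < α) (hβ : 0 < β) (hαβ : α + β < 1)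
    {r s O : ℝ × ℝ} (hrs : LinearIndependent ℝ ![r, s]) {η ξ : ℝ × ℝ → ℝ}
    (hcoord : ∀ p : ℝ × ℝ, p = O + η p • r + ξ p • s) :
    bilinearMap α β r s O '' (Set.Icc (-1 : ℝ) 1 ×ˢ Set.Icc (-1 : ℝ) 1) =
      convexHull ℝ {O + (-1 - α) • r + (1 - β) • s, O + (-1 + α) • r + (-1 + β) • s,
        O + (1 - α) • r + (-1 - β) • s, O + (1 + α) • r + (1 + β) • s} := by
  have hcomb (p q : ℝ × ℝ) {a b : ℝ} (hab : a + b = 1) :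
      η (a • p + b • q) = a * η p + b * η q ∧ ξ (a • p + b • q) = a * ξ p + b * ξ q := by
    apply coord_unique hrs (O := O)
    rw [← hcoord]
    nth_rw 1 [hcoord p, hcoord q]
    obtain rfl : a = 1 - b := by linarith
    module
  have hc (x y : ℝ) := coord_unique hrs (hcoord (O + x • r + y • s)).symm
  apply Set.Subset.antisymm
  · rintro _ ⟨⟨x, y⟩, ⟨⟨hx, hx'⟩, hy, hy'⟩, rfl⟩
    dsimp only at hx hx' hy hy'
    set V : Set (ℝ × ℝ) := {O + (-1 - α) • r + (1 - β) • s, O + (-1 + α) • r + (-1 + β) • s,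
        O + (1 - α) • r + (-1 - β) • s, O + (1 + α) • r + (1 + β) • s} with hV
    have hconv := convex_convexHull ℝ V
    have hmem {p} (hp : p ∈ V) := subset_convexHull ℝ V hp
    have hleft := hconv (hmem (by simp [hV] : O + (-1 - α) • r + (1 - β) • s ∈ V))
      (hmem (by simp [hV] : O + (-1 + α) • r + (-1 + β) • s ∈ V))
      (show 0 ≤ (1 + y) / 2 by linarith) (show 0 ≤ (1 - y) / 2 by linarith) (by ring)
    have hright := hconv (hmem (by simp [hV] : O + (1 + α) • r + (1 + β) • s ∈ V))
      (hmem (by simp [hV] : O + (1 - α) • r + (-1 - β) • s ∈ V))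
      (show 0 ≤ (1 + y) / 2 by linarith) (show 0 ≤ (1 - y) / 2 by linarith) (by ring)
    convert hconv hleft hright
      (show 0 ≤ (1 - x) / 2 by linarith) (show 0 ≤ (1 + x) / 2 by linarith) (by ring) using 1
    simp only [bilinearMap]
    module
  · have hsub : convexHull ℝ {O + (-1 - α) • r + (1 - β) • s, O + (-1 + α) • r + (-1 + β) • s,
        O + (1 - α) • r + (-1 - β) • s, O + (1 + α) • r + (1 + β) • s} ⊆
        {p | 0 ≤ (1 - β) * (η p + 1) + α * ξ p ∧ 0 ≤ (1 - α) * (ξ p + 1) + β * η p ∧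
          0 ≤ (1 + β) * (1 - η p) + α * ξ p ∧ 0 ≤ (1 + α) * (1 - ξ p) + β * η p} := by
      apply convexHull_min
      · simp only [Set.insert_subset_iff, Set.singleton_subset_iff, Set.mem_ofPred_eq, hc]
        refine ⟨⟨?_, ?_, ?_, ?_⟩, ⟨?_, ?_, ?_, ?_⟩, ⟨?_, ?_, ?_, ?_⟩, ?_, ?_, ?_, ?_⟩ <;> nlinarith
      · rintro p ⟨hp₁, hp₂, hp₃, hp₄⟩ q ⟨hq₁, hq₂, hq₃, hq₄⟩ a b ha hb hab
        simp only [Set.mem_ofPred_eq, hcomb p q hab]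
        obtain rfl : a = 1 - b := by linarith
        refine ⟨?_, ?_, ?_, ?_⟩
        · linear_combination (1 - b) * hp₁ + b * hq₁
        · linear_combination (1 - b) * hp₂ + b * hq₂
        · linear_combination (1 - b) * hp₃ + b * hq₃
        · linear_combination (1 - b) * hp₄ + b * hq₄
    intro p hp
    obtain ⟨h₁, h₂, h₃, h₄⟩ := hsub hp
    obtain ⟨q, hq, hx, hy⟩ := exists_bilinear_preimage hα hβ hαβ h₁ h₂ h₃ h₄
    refine ⟨q, hq, ?_⟩
    rw [bilinearMap, hx, hy, ← hcoord]

theorem setIntegral_quadrilateral {α β : ℝ} (hα : 0 < α) (hβ : 0 < β) (hαβ : α + β < 1)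
    {r s O : ℝ × ℝ} (hrs : LinearIndependent ℝ ![r, s]) {η ξ : ℝ × ℝ → ℝ}
    (hcoord : ∀ p : ℝ × ℝ, p = O + η p • r + ξ p • s) (a b c d e : ℝ) :
    ∫ p in bilinearMap α β r s O '' (Set.Icc (-1 : ℝ) 1 ×ˢ Set.Icc (-1 : ℝ) 1),
        separableQuadratic a b c d e (η p) (ξ p)
      = |r.1 * s.2 - r.2 * s.1| *
        (4 * (a + b * α / 3 + c * β / 3 + d * (1 + β ^ 2) / 3 + e * (1 + α ^ 2) / 3)) := by
  have hmeas : MeasurableSet (Set.Icc (-1 : ℝ) 1 ×ˢ Set.Icc (-1 : ℝ) 1) :=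
    measurableSet_Icc.prod measurableSet_Icc
  rw [integral_image_eq_integral_abs_det_fderiv_smul volume hmeas
    (fun p _ => (hasFDerivAt_bilinearMap α β r s O p).hasFDerivWithinAt)
    (injOn_bilinearMap hα hβ hαβ hrs O), ← setIntegral_square_jacobian_mul,
    ← integral_const_mul]
  refine setIntegral_congr_fun hmeas ?_
  rintro ⟨x, y⟩ ⟨⟨hx, hx'⟩, hy, hy'⟩
  dsimp only at hx hx' hy hy'
  have hJ : 0 < 1 + α * y + β * x := by nlinarith
  have hc := coord_unique hrs (hcoord (bilinearMap α β r s O (x, y))).symm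
  simp only [det_bilinearMapDeriv, abs_mul, abs_of_pos hJ, smul_eq_mul, hc]
  ring

theorem setAvg_quadrilateral {α β : ℝ} (hα : 0 < α) (hβ : 0 < β) (hαβ : α + β < 1)
    {r s O : ℝ × ℝ} (hrs : LinearIndependent ℝ ![r, s]) {η ξ : ℝ × ℝ → ℝ}
    (hcoord : ∀ p : ℝ × ℝ, p = O + η p • r + ξ p • s) (a b c d e : ℝ) :
    setAvg (convexHull ℝ {O + (-1 - α) • r + (1 - β) • s, O + (-1 + α) • r + (-1 + β) • s,
        O + (1 - α) • r + (-1 - β) • s, O + (1 + α) • r + (1 + β) • s})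
        (fun p => separableQuadratic a b c d e (η p) (ξ p))
      = a + b * α / 3 + c * β / 3 + d * (1 + β ^ 2) / 3 + e * (1 + α ^ 2) / 3 := by
  have hvol := setIntegral_quadrilateral hα hβ hαβ hrs hcoord 1 0 0 0 0
  simp only [separableQuadratic, zero_mul, add_zero, setIntegral_const, smul_eq_mul, mul_one,
    zero_div, measureReal_def] at hvol
  rw [setAvg, ← image_bilinearMap_square hα hβ hαβ hrs hcoord,
    setIntegral_quadrilateral hα hβ hαβ hrs hcoord, hvol]
  have := abs_pos.2 (det_ne_zero_of_linearIndependent hrs)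
  field_simp

theorem segAvg_separableQuadratic {r s O : ℝ × ℝ} (hrs : LinearIndependent ℝ ![r, s])
    {η ξ : ℝ × ℝ → ℝ} (hcoord : ∀ p : ℝ × ℝ, p = O + η p • r + ξ p • s)
    (a b c d e x y z w : ℝ) :
    segAvg (O + x • r + y • s) (O + z • r + w • s)
        (fun p => separableQuadratic a b c d e (η p) (ξ p))
      = a + b * (y + w) / 2 + c * (x + z) / 2 + d * (y ^ 2 + y * w + w ^ 2) / 3
        + e * (x ^ 2 + x * z + z ^ 2) / 3 := by
  have hseg (t : ℝ) : (1 - t) • (O + x • r + y • s) + t • (O + z • r + w • s)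
      = O + (x + t * (z - x)) • r + (y + t * (w - y)) • s := by module
  have hc (x y : ℝ) := coord_unique hrs (hcoord (O + x • r + y • s)).symm
  simp only [segAvg, hseg, hc, separableQuadratic]
  calc
    _ = ∫ t in (0 : ℝ)..1, ((a + b * y + c * x + d * y ^ 2 + e * x ^ 2)
          + (b * (w - y) + c * (z - x) + 2 * d * y * (w - y) + 2 * e * x * (z - x)) * t
          + (d * (w - y) ^ 2 + e * (z - x) ^ 2) * t ^ 2) := by
      congr 1
      ext t
      ring
    _ = _ := by
      rw [integral_quadratic_unit]
      ring

theorem mem_span_iff_separableQuadratic {η ξ v : ℝ × ℝ → ℝ} :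
    v ∈ Submodule.span ℝ
      ({fun _ => 1, ξ, η, fun p => ξ p ^ 2, fun p => η p ^ 2} : Set (ℝ × ℝ → ℝ)) ↔
    ∃ a b c d e : ℝ, v = fun p => separableQuadratic a b c d e (η p) (ξ p) := by
  simp only [Submodule.mem_span_insert, Submodule.mem_span_singleton]
  constructor
  · rintro ⟨a, _, ⟨b, _, ⟨c, _, ⟨d, _, ⟨e, rfl⟩, rfl⟩, rfl⟩, rfl⟩, rfl⟩
    refine ⟨a, b, c, d, e, ?_⟩
    ext p
    simp [separableQuadratic]
    ring
  · rintro ⟨a, b, c, d, e, rfl⟩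
    refine ⟨a, _, ⟨b, _, ⟨c, _, ⟨d, _, ⟨e, rfl⟩, rfl⟩, rfl⟩, rfl⟩, ?_⟩
    ext p
    simp [separableQuadratic]
    ring

/-- Unisolvence of the QLTZ element on a general convex quadrilateral: with `r`, `s`
linearly independent, `O ∈ ℝ²`, and the Park–Sheen affine coordinates `η`, `ξ`
determined by p = O + η(p)·r + ξ(p)·s, let A₁, …, A₄ be the vertices of the convex
quadrilateral Q = conv{A₁, A₂, A₃, A₄} with edges E₁ = [A₁,A₂], E₂ = [A₂,A₃],
E₃ = [A₃,A₄], E₄ = [A₄,A₁]. Then the linear map from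
P_Q = span_ℝ{1, ξ, η, ξ², η²} to ℝ⁵ given by
v ↦ (⨍_Q v, ⨍_{E₁}v, ⨍_{E₂}v, ⨍_{E₃}v, ⨍_{E₄}v) is bijective. -/
theorem QLTZ_unisolvent_general (α β : ℝ) (hα : 0 < α) (hβ : 0 < β) (hαβ : α + β < 1)
    (r s : ℝ × ℝ) (hrs : LinearIndependent ℝ ![r, s]) (O : ℝ × ℝ)
    (η ξ : ℝ × ℝ → ℝ) (hcoord : ∀ p : ℝ × ℝ, p = O + η p • r + ξ p • s)
    (A1 A2 A3 A4 : ℝ × ℝ)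
    (hA1 : A1 = O + (-1 - α) • r + (1 - β) • s)
    (hA2 : A2 = O + (-1 + α) • r + (-1 + β) • s)
    (hA3 : A3 = O + (1 - α) • r + (-1 - β) • s)
    (hA4 : A4 = O + (1 + α) • r + (1 + β) • s)
    (Q : Set (ℝ × ℝ)) (hQ : Q = convexHull ℝ {A1, A2, A3, A4})
    (PQ : Submodule ℝ (ℝ × ℝ → ℝ))
    (hPQ : PQ = Submodule.span ℝ
      ({fun _ => 1, ξ, η, fun p => ξ p ^ 2, fun p => η p ^ 2} : Set (ℝ × ℝ → ℝ))) :
    Function.Bijective (fun v : PQ =>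
      (![setAvg Q v.1, segAvg A1 A2 v.1, segAvg A2 A3 v.1,
         segAvg A3 A4 v.1, segAvg A4 A1 v.1] : Fin 5 → ℝ)) := by
  subst hQ hA1 hA2 hA3 hA4 hPQ
  have hdof (a b c d e : ℝ) :
      (![setAvg (convexHull ℝ {O + (-1 - α) • r + (1 - β) • s, O + (-1 + α) • r + (-1 + β) • s,
            O + (1 - α) • r + (-1 - β) • s, O + (1 + α) • r + (1 + β) • s})
            (fun p => separableQuadratic a b c d e (η p) (ξ p)),
          segAvg (O + (-1 - α) • r + (1 - β) • s) (O + (-1 + α) • r + (-1 + β) • s)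
            (fun p => separableQuadratic a b c d e (η p) (ξ p)),
          segAvg (O + (-1 + α) • r + (-1 + β) • s) (O + (1 - α) • r + (-1 - β) • s)
            (fun p => separableQuadratic a b c d e (η p) (ξ p)),
          segAvg (O + (1 - α) • r + (-1 - β) • s) (O + (1 + α) • r + (1 + β) • s)
            (fun p => separableQuadratic a b c d e (η p) (ξ p)),
          segAvg (O + (1 + α) • r + (1 + β) • s) (O + (-1 - α) • r + (1 - β) • s)
            (fun p => separableQuadratic a b c d e (η p) (ξ p))] : Fin 5 → ℝ)
        = ![a + b * α / 3 + c * β / 3 + d * (1 + β ^ 2) / 3 + e * (1 + α ^ 2) / 3,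
            a - c + d * (1 - β) ^ 2 / 3 + e * (1 + α ^ 2 / 3),
            a - b + d * (1 + β ^ 2 / 3) + e * (1 - α) ^ 2 / 3,
            a + c + d * (1 + β) ^ 2 / 3 + e * (1 + α ^ 2 / 3),
            a + b + d * (1 + β ^ 2 / 3) + e * (1 + α) ^ 2 / 3] := by
    rw [setAvg_quadrilateral hα hβ hαβ hrs hcoord]
    simp only [segAvg_separableQuadratic hrs hcoord]
    congrm ![_, ?_, ?_, ?_, ?_] <;> ring
  have hpos : 0 < 3 + α ^ 2 + β ^ 2 := by positivity
  constructor
  · rintro ⟨v, hv⟩ ⟨v', hv'⟩ h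
    obtain ⟨a, b, c, d, e, rfl⟩ := mem_span_iff_separableQuadratic.1 hv
    obtain ⟨a', b', c', d', e', rfl⟩ := mem_span_iff_separableQuadratic.1 hv'
    dsimp only at h
    rw [hdof, hdof] at h
    have h0 := congrFun h 0
    have h1 := congrFun h 1
    have h2 := congrFun h 2
    have h3 := congrFun h 3
    have h4 := congrFun h 4
    simp only [Matrix.cons_val] at h0 h1 h2 h3 h4
    have hde : d - d' = e - e' := by linear_combination 3 / 4 * (h2 + h4 - h1 - h3)
    have hc : c - c' = -2 * β / 3 * (d - d') := by linear_combination (h3 - h1) / 2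
    have hb : b - b' = -2 * α / 3 * (e - e') := by linear_combination (h4 - h2) / 2
    have he : e = e' := by
      apply sub_eq_zero.1
      apply (mul_eq_zero.1 (?_ : (3 + α ^ 2 + β ^ 2) * (e - e') = 0)).resolve_left hpos.ne'
      linear_combination 9 / 2 * ((h1 + h3) / 2 - h0) + 3 / 2 * α * hb + 3 / 2 * β * hc - β ^ 2 * hde
    obtain rfl := he
    obtain rfl : d = d' := by linarith
    obtain rfl : b = b' := by linarith
    obtain rfl : c = c' := by linarith
    obtain rfl : a = a' := by linarith
    rfl
  · intro y
    set m := (y 1 + y 3) / 2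
    set δ := 3 / 4 * (y 2 + y 4 - y 1 - y 3)
    set e := (9 / 2 * (m - y 0) + 3 / 4 * (α * (y 4 - y 2) + β * (y 3 - y 1)) - β ^ 2 * δ)
      / (3 + α ^ 2 + β ^ 2) with he
    set d := e + δ
    set b := (y 4 - y 2) / 2 - 2 * α / 3 * e
    set c := (y 3 - y 1) / 2 - 2 * β / 3 * d
    set a := m - d * (1 + β ^ 2) / 3 - e * (1 + α ^ 2 / 3)
    refine ⟨⟨_, mem_span_iff_separableQuadratic.2 ⟨a, b, c, d, e, rfl⟩⟩, ?_⟩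
    dsimp only
    rw [hdof]
    rw [eq_div_iff hpos.ne'] at he
    ext i
    fin_cases i <;> simp only [Fin.reduceFinMk, Fin.zero_eta, Matrix.cons_val]
    · simp only [a, b, c, d, m, δ] at he ⊢
      linear_combination -2 / 9 * he
    all_goals simp only [a, b, c, d, m, δ]; ring
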